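/- arXiv:1605.08752 — 3 statements merged into one kernel-verified Lean document; each statement's English description precedes it below -/
import Mathlib

section
/- If T is a t-transversal of a subfamily 𝒜 of a family ℱ, X is a set of size t, 𝒜 ⊆ ℱ(X), and X is not a subset of T, then |𝒜| ≤ |T \ X|·l(ℱ,t+1). -/
open Finset

section Defs

variable {α : Type*} [DecidableEq α]

/-- `famStar F T` is ℱ(T) = {F ∈ ℱ : T ⊆ F}. -/
def famStar (F : Finset (Finset α)) (T : Finset α) : Finset (Finset α) :=
  F.filter (fun A => T ⊆ A)

/-- `lstar F t` is l(ℱ,t): the maximum of |ℱ(T)| over all t-element sets T. -/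
noncomputable def lstar (F : Finset (Finset α)) (t : ℕ) : ℕ :=
  sSup {n : ℕ | ∃ T : Finset α, T.card = t ∧ n = (famStar F T).card}

/-- c(r,s,t) = max{r·C(s,t), s·C(r,t)} + 1 if t ≤ min{r,s}, and 1 otherwise. -/
def cfun (r s t : ℕ) : ℕ :=
  if t ≤ min r s then max (r * Nat.choose s t) (s * Nat.choose r t) + 1 else 1

/-- The tuple (𝒜_1, …, 𝒜_k) is cross-t-intersecting. -/
def CrossTuple (t : ℕ) {k : ℕ} (A : Fin k → Finset (Finset α)) : Prop :=
  ∀ i j : Fin k, i ≠ j → ∀ a ∈ A i, ∀ b ∈ A j, t ≤ (a ∩ b).card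

/-- The cross-t-star property. -/
def CrossTStar (t : ℕ) {k : ℕ} (F : Fin k → Finset (Finset α)) : Prop :=
  ∀ A : Fin k → Finset (Finset α), CrossTuple t A → (∀ i, A i ⊆ F i) →
    ∏ i, (A i).card ≤ ∏ i, lstar (F i) t

/-- The strict cross-t-star property. -/
def StrictCrossTStar (t : ℕ) {k : ℕ} (F : Fin k → Finset (Finset α)) : Prop :=
  ∀ A : Fin k → Finset (Finset α), CrossTuple t A → (∀ i, A i ⊆ F i) →
    ∏ i, (A i).card ≤ ∏ i, lstar (F i) t ∧
      ((¬ ∃ T : Finset α, T.card = t ∧ ∀ i, A i = famStar (F i) T) →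
        ∏ i, (A i).card < ∏ i, lstar (F i) t)

/-- The strong cross-t-star property. -/
def StrongCrossTStar (t : ℕ) {k : ℕ} (F : Fin k → Finset (Finset α)) : Prop :=
  ∃ T : Finset α, T.card = t ∧
    ∀ A : Fin k → Finset (Finset α), CrossTuple t A → (∀ i, A i ⊆ F i) →
      ∏ i, (A i).card ≤ ∏ i, (famStar (F i) T).card

/-- The extrastrong cross-t-star property. -/
def ExtrastrongCrossTStar (t : ℕ) {k : ℕ} (F : Fin k → Finset (Finset α)) : Prop :=
  ∃ T : Finset α, T.card = t ∧
    ∀ A : Fin k → Finset (Finset α), CrossTuple t A → (∀ i, A i ⊆ F i) →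
      ∏ i, (A i).card ≤ ∏ i, (famStar (F i) T).card ∧
        (∏ i, (A i).card = ∏ i, (famStar (F i) T).card →
          ∃ T' : Finset α, T'.card = t ∧ ∀ i, A i = famStar (F i) T')

/-- 𝒮_{X,m}: the family of subsets of X × [m] that are graphs of functions
from X to [m]; 𝒮_{∅,m} = ∅. -/
def seqFam (X : Finset α) (m : ℕ) : Finset (Finset (α × ℕ)) :=
  (X ×ˢ Finset.Icc 1 m).powerset.filter
    (fun S => S.Nonempty ∧ S.image Prod.fst = X ∧ S.card = X.card)

/-- 𝒮_{ℱ,m} = ⋃_{F ∈ ℱ} 𝒮_{F,m}. -/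
def seqFamU (F : Finset (Finset α)) (m : ℕ) : Finset (Finset (α × ℕ)) :=
  F.biUnion (fun X => seqFam X m)

/-- 𝒮*_{X,m}: the family of subsets of X × [m] that are graphs of injective
functions from X to [m]; 𝒮*_{∅,m} = ∅. -/
def seqFamInj (X : Finset α) (m : ℕ) : Finset (Finset (α × ℕ)) :=
  (seqFam X m).filter (fun S => (S.image Prod.snd).card = S.card)

/-- 𝒮*_{ℱ,m} = ⋃_{F ∈ ℱ} 𝒮*_{F,m}. -/
def seqFamInjU (F : Finset (Finset α)) (m : ℕ) : Finset (Finset (α × ℕ)) :=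
  F.biUnion (fun X => seqFamInj X m)

end Defs

open Classical in
/-- ℳ_{n,r}: representations S_A of multisets A with members in [n] of total size r:
the r-element sets S of pairs (a,j) with a ∈ [n], 1 ≤ j, such that (a,j) ∈ S and
1 ≤ j' ≤ j imply (a,j') ∈ S. -/
noncomputable def multFam (n r : ℕ) : Finset (Finset (ℕ × ℕ)) :=
  (Finset.Icc 1 n ×ˢ Finset.Icc 1 r).powerset.filter
    (fun S => S.card = r ∧ ∀ p ∈ S, ∀ j ∈ Finset.Icc 1 p.2, (p.1, j) ∈ S)

/-- 𝒞_{n,r}: representations S_a = {(1,a_1),…,(r,a_r)} of compositions (a_1,…,a_r)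
of n of length r, i.e. graphs of functions from [r] to positive integers summing to n. -/
def compFam (n r : ℕ) : Finset (Finset (ℕ × ℕ)) :=
  (Finset.Icc 1 r ×ˢ Finset.Icc 1 n).powerset.filter
    (fun S => S.image Prod.fst = Finset.Icc 1 r ∧ S.card = r ∧ ∑ p ∈ S, p.2 = n)

/-- 𝖯_{n,r}: the family of partitions of [n] of length r, each partition viewed
as the set of its parts. -/
def partFam (n r : ℕ) : Finset (Finset (Finset ℕ)) :=
  (Finset.Icc 1 n).powerset.powerset.filter
    (fun P => P.card = r ∧ (∀ X ∈ P, X ≠ ∅) ∧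
      (∀ X ∈ P, ∀ Y ∈ P, X ≠ Y → X ∩ Y = ∅) ∧
      P.biUnion id = Finset.Icc 1 n)

/-- s_{n,r} = |𝖯_{n,r}|, the Stirling number of the second kind. -/
def stirling (n r : ℕ) : ℕ := (partFam n r).card

theorem card_famStar_le_lstar {α : Type*} [DecidableEq α] (F : Finset (Finset α))
    (T : Finset α) : (famStar F T).card ≤ lstar F T.card := by
  refine le_csSup ⟨F.card, ?_⟩ ⟨T, rfl, rfl⟩
  rintro n ⟨S, -, rfl⟩
  exact card_filter_le _ _

/-- Lemma 3.2. -/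
theorem stmt_7 {α : Type*} [DecidableEq α] (t : ℕ)
    (F A : Finset (Finset α)) (hA : A ⊆ F)
    (T X : Finset α) (hT : ∀ a ∈ A, t ≤ (T ∩ a).card)
    (hX : X.card = t) (hAX : A ⊆ famStar F X) (hXT : ¬ X ⊆ T) :
    A.card ≤ (T \ X).card * lstar F (t + 1) := by
  have hcover : A ⊆ (T \ X).biUnion fun x => famStar F (insert x X) := by
    intro a ha
    have hXa : X ⊆ a := (mem_filter.mp (hAX ha)).2
    have hlt : (T ∩ X).card < (T ∩ a).card := by
      refine lt_of_lt_of_le ?_ (hX.le.trans (hT a ha))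
      exact card_lt_card ⟨inter_subset_right, fun h => hXT (h.trans inter_subset_left)⟩
    obtain ⟨x, hxTa, hxTX⟩ := exists_mem_notMem_of_card_lt_card hlt
    obtain ⟨hxT, hxa⟩ := mem_inter.mp hxTa
    refine mem_biUnion.mpr ⟨x, mem_sdiff.mpr ⟨hxT, fun hx => hxTX (mem_inter.mpr ⟨hxT, hx⟩)⟩, ?_⟩
    exact mem_filter.mpr ⟨hA ha, insert_subset hxa hXa⟩
  refine (card_le_card hcover).trans (card_biUnion_le_card_mul _ _ _ fun x hx => ?_)
  rw [← hX, ← card_insert_of_notMem (mem_sdiff.mp hx).2]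
  exact card_famStar_le_lstar F (insert x X)
end

section
/- Let k ≥ 2 and 1 ≤ t ≤ r_1 ≤ … ≤ r_k, and for each i ∈ [k] let ℱ_i = ℳ_{n_i,r_i}, where n_i ≥ (r_i − t)·c(r_{k−1},r_k,t) − r_i + t + 1. Then (ℱ_1, …, ℱ_k) has the extrastrong cross-t-star property. -/
open Finset

theorem card_le_choose_mul_of_inter {α : Type*} [DecidableEq α] {t L : ℕ}
    {B : Finset (Finset α)} {a : Finset α} (hB : ∀ b ∈ B, t ≤ (a ∩ b).card)
    (hL : ∀ T : Finset α, T.card = t → (famStar B T).card ≤ L) :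
    B.card ≤ a.card.choose t * L := by
  have hsub : B ⊆ (a.powersetCard t).biUnion (famStar B) := by
    intro b hb
    obtain ⟨T, hT, hTc⟩ := Finset.exists_subset_card_eq (hB b hb)
    simp only [Finset.mem_biUnion, Finset.mem_powersetCard, famStar, Finset.mem_filter]
    exact ⟨T, ⟨hT.trans Finset.inter_subset_left, hTc⟩, hb, hT.trans Finset.inter_subset_right⟩
  calc B.card ≤ _ := Finset.card_le_card hsub
    _ ≤ (a.powersetCard t).card * L :=
      Finset.card_biUnion_le_card_mul _ _ _ fun T hT => hL T (Finset.mem_powersetCard.1 hT).2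
    _ = _ := by rw [Finset.card_powersetCard]

theorem card_famStar_le_mul_of_not_subset {α : Type*} [DecidableEq α] {t M : ℕ}
    {B : Finset (Finset α)} {a T : Finset α} (hB : ∀ b ∈ B, t ≤ (a ∩ b).card)
    (hT : T.card = t) (hTa : ¬ T ⊆ a)
    (hM : ∀ U : Finset α, U.card = t + 1 → (famStar B U).card ≤ M) :
    (famStar B T).card ≤ a.card * M := by
  have hsub : famStar B T ⊆ (a \ T).biUnion fun x => famStar B (insert x T) := by
    intro b hb
    simp only [famStar, Finset.mem_filter] at hb
    obtain ⟨hb, hTb⟩ := hb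
    have : ∃ x ∈ a ∩ b, x ∉ T := by
      by_contra! h
      exact hTa ((Finset.eq_of_subset_of_card_le (fun x hx => h x hx)
        (hT.trans_le (hB b hb))) ▸ Finset.inter_subset_left)
    obtain ⟨x, hx, hxT⟩ := this
    rw [Finset.mem_inter] at hx
    simp only [Finset.mem_biUnion, Finset.mem_sdiff, famStar, Finset.mem_filter]
    exact ⟨x, ⟨hx.1, hxT⟩, hb, Finset.insert_subset hx.2 hTb⟩
  calc (famStar B T).card ≤ _ := Finset.card_le_card hsub
    _ ≤ (a \ T).card * M := Finset.card_biUnion_le_card_mul _ _ _ fun x hx =>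
      hM _ (by rw [Finset.card_insert_of_notMem (Finset.mem_sdiff.1 hx).2, hT])
    _ ≤ _ := Nat.mul_le_mul_right _ (Finset.card_le_card Finset.sdiff_subset)

theorem famStar_mono {α : Type*} [DecidableEq α] {A F : Finset (Finset α)} (h : A ⊆ F)
    (T : Finset α) : famStar A T ⊆ famStar F T :=
  Finset.filter_subset_filter _ h

theorem subset_famStar {α : Type*} [DecidableEq α] {A F : Finset (Finset α)} {T : Finset α}
    (h : A ⊆ F) (hT : ∀ a ∈ A, T ⊆ a) : A ⊆ famStar F T :=
  fun a ha => Finset.mem_filter.2 ⟨h ha, hT a ha⟩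

/-- If `A` is a star with centre `T` but `B` is not, the product of sizes is small. -/
theorem card_mul_card_lt_of_star {α : Type*} [DecidableEq α] {t r s D lF lG M : ℕ}
    {A B : Finset (Finset α)} (hAB : ∀ a ∈ A, ∀ b ∈ B, t ≤ (a ∩ b).card)
    (hr : ∀ a ∈ A, a.card = r) (hs : ∀ b ∈ B, b.card = s)
    (hlG : 0 < lG) (hBG : ∀ T : Finset α, T.card = t → (famStar B T).card ≤ lG)
    (hAM : ∀ U : Finset α, U.card = t + 1 → (famStar A U).card ≤ M)
    (hD : s * r.choose t ≤ D) (hDM : D * M < lF)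
    {T : Finset α} (hT : T.card = t) (hAT : ∀ a ∈ A, T ⊆ a) (hBT : ∃ b ∈ B, ¬ T ⊆ b) :
    A.card * B.card < lF * lG := by
  obtain ⟨b, hb, hTb⟩ := hBT
  rcases A.eq_empty_or_nonempty with rfl | ⟨a, ha⟩
  · rw [Finset.card_empty, Nat.zero_mul]
    exact Nat.mul_pos (Nat.zero_lt_of_lt hDM) hlG
  have h1 : A.card ≤ s * M := by
    rw [← hs b hb]
    refine le_trans (Finset.card_le_card (subset_famStar subset_rfl hAT)) ?_
    exact card_famStar_le_mul_of_not_subset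
      (fun a ha => by rw [Finset.inter_comm]; exact hAB a ha b hb) hT hTb hAM
  have h2 : B.card ≤ r.choose t * lG := by
    rw [← hr a ha]
    exact card_le_choose_mul_of_inter (hAB a ha) hBG
  calc A.card * B.card ≤ (s * M) * (r.choose t * lG) := Nat.mul_le_mul h1 h2
    _ = (s * r.choose t) * M * lG := by ring
    _ ≤ D * M * lG := by gcongr
    _ < lF * lG := by gcongr

theorem common_star_or_card_mul_card_lt {α : Type*} [DecidableEq α] {t r s D lF lG MF MG : ℕ}
    {A B : Finset (Finset α)} (hAB : ∀ a ∈ A, ∀ b ∈ B, t ≤ (a ∩ b).card)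
    (hr : ∀ a ∈ A, a.card = r) (hs : ∀ b ∈ B, b.card = s)
    (hAF : ∀ T : Finset α, T.card = t → (famStar A T).card ≤ lF)
    (hBG : ∀ T : Finset α, T.card = t → (famStar B T).card ≤ lG)
    (hAM : ∀ U : Finset α, U.card = t + 1 → (famStar A U).card ≤ MF)
    (hBM : ∀ U : Finset α, U.card = t + 1 → (famStar B U).card ≤ MG)
    (hD : s * r.choose t ≤ D) (hD' : r * s.choose t ≤ D)
    (hDF : D * MF < lF) (hDG : D * MG < lG) :
    (∃ T : Finset α, T.card = t ∧ (∀ a ∈ A, T ⊆ a) ∧ ∀ b ∈ B, T ⊆ b) ∨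
      A.card * B.card < lF * lG := by
  have hlF := Nat.zero_lt_of_lt hDF
  have hlG := Nat.zero_lt_of_lt hDG
  have hBA : ∀ b ∈ B, ∀ a ∈ A, t ≤ (b ∩ a).card := fun b hb a ha => by
    rw [Finset.inter_comm]; exact hAB a ha b hb
  by_cases hA : ∃ T : Finset α, T.card = t ∧ ∀ a ∈ A, T ⊆ a
  · obtain ⟨T, hT, hAT⟩ := hA
    by_cases hBT : ∀ b ∈ B, T ⊆ b
    · exact Or.inl ⟨T, hT, hAT, hBT⟩
    · push Not at hBT
      exact Or.inr (card_mul_card_lt_of_star hAB hr hs hlG hBG hAM hD hDF hT hAT hBT)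
  by_cases hB : ∃ T : Finset α, T.card = t ∧ ∀ b ∈ B, T ⊆ b
  · obtain ⟨T, hT, hBT⟩ := hB
    by_cases hAT : ∀ a ∈ A, T ⊆ a
    · exact Or.inl ⟨T, hT, hAT, hBT⟩
    · push Not at hAT
      rw [mul_comm, mul_comm lF]
      exact Or.inr (card_mul_card_lt_of_star hBA hs hr hlF hAF hBM hD' hDG hT hBT hAT)
  right
  push Not at hA hB
  rcases A.eq_empty_or_nonempty with rfl | ⟨a, ha⟩
  · rw [Finset.card_empty, Nat.zero_mul]; exact Nat.mul_pos hlF hlG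
  rcases B.eq_empty_or_nonempty with rfl | ⟨b, hb⟩
  · rw [Finset.card_empty, Nat.mul_zero]; exact Nat.mul_pos hlF hlG
  have h1 : A.card ≤ s.choose t * (s * MF) := by
    rw [← hs b hb]
    refine card_le_choose_mul_of_inter (hBA b hb) fun T hT => ?_
    obtain ⟨b', hb', hTb'⟩ := hB T hT
    rw [hs b hb, ← hs b' hb']
    exact card_famStar_le_mul_of_not_subset (hBA b' hb') hT hTb' hAM
  have h2 : B.card ≤ r.choose t * (r * MG) := by
    rw [← hr a ha]
    refine card_le_choose_mul_of_inter (hAB a ha) fun T hT => ?_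
    obtain ⟨a', ha', hTa'⟩ := hA T hT
    rw [hr a ha, ← hr a' ha']
    exact card_famStar_le_mul_of_not_subset (hAB a' ha') hT hTa' hBM
  calc A.card * B.card ≤ (s.choose t * (s * MF)) * (r.choose t * (r * MG)) :=
        Nat.mul_le_mul h1 h2
    _ = ((s * r.choose t) * MF) * ((r * s.choose t) * MG) := by ring
    _ ≤ (D * MF) * (D * MG) := by gcongr
    _ < lF * lG := Nat.mul_lt_mul'' hDF hDG

/-- Uniform families whose largest `t`-stars dominate all their `(t+1)`-stars have the
extrastrong cross-`t`-star property. -/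
theorem extrastrongCrossTStar_of_card_famStar {α : Type*} [DecidableEq α] {k t D : ℕ}
    (hk : 2 ≤ k) {F : Fin k → Finset (Finset α)} {r M : Fin k → ℕ}
    (hr : ∀ i, ∀ a ∈ F i, a.card = r i) {T₀ : Finset α} (hT₀ : T₀.card = t)
    (hmax : ∀ i, ∀ T : Finset α, T.card = t → (famStar (F i) T).card ≤ (famStar (F i) T₀).card)
    (hM : ∀ i, ∀ U : Finset α, U.card = t + 1 → (famStar (F i) U).card ≤ M i)
    (hDM : ∀ i, D * M i < (famStar (F i) T₀).card) (hD0 : 1 ≤ D)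
    (hD : ∀ i j, i ≠ j → r i * (r j).choose t ≤ D) :
    ExtrastrongCrossTStar t F := by
  refine ⟨T₀, hT₀, fun A hA hAF => ?_⟩
  set l : Fin k → ℕ := fun i => (famStar (F i) T₀).card with hl
  have hpair : ∀ i j, i ≠ j →
      (∃ T : Finset α, T.card = t ∧ (∀ a ∈ A i, T ⊆ a) ∧ ∀ b ∈ A j, T ⊆ b) ∨
        (A i).card * (A j).card < l i * l j := fun i j hij =>
    common_star_or_card_mul_card_lt (hA i j hij) (fun a ha => hr i a (hAF i ha))
      (fun a ha => hr j a (hAF j ha))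
      (fun T hT => (Finset.card_le_card (famStar_mono (hAF i) T)).trans (hmax i T hT))
      (fun T hT => (Finset.card_le_card (famStar_mono (hAF j) T)).trans (hmax j T hT))
      (fun T hT => (Finset.card_le_card (famStar_mono (hAF i) T)).trans (hM i T hT))
      (fun T hT => (Finset.card_le_card (famStar_mono (hAF j) T)).trans (hM j T hT))
      (hD j i hij.symm) (hD i j hij) (hDM i) (hDM j)
  have hstar : ∀ i (T : Finset α), T.card = t → (∀ a ∈ A i, T ⊆ a) → (A i).card ≤ l i :=
    fun i T hT h => (Finset.card_le_card (subset_famStar (hAF i) h)).trans (hmax i T hT)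
  have hlpos : ∀ i, 0 < l i := fun i => Nat.zero_lt_of_lt (hDM i)
  by_cases hbig : ∃ i, l i < (A i).card
  · obtain ⟨i, hi⟩ := hbig
    have hlt : ∀ j, j ≠ i → (A i).card * (A j).card < l i * l j := fun j hj =>
      (hpair i j hj.symm).resolve_left fun ⟨T, hT, h, _⟩ => (hstar i T hT h).not_gt hi
    have hle : ∀ j, j ≠ i → (A j).card ≤ l j := fun j hj => by
      by_contra! h
      exact (hlt j hj).not_gt (Nat.mul_lt_mul'' hi h)
    have : Nontrivial (Fin k) := Fin.nontrivial_iff_two_le.2 hk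
    obtain ⟨j, hj⟩ := exists_ne i
    have hprod : ∏ i, (A i).card < ∏ i, l i := by
      have hmem : j ∈ Finset.univ.erase i := Finset.mem_erase.2 ⟨hj, Finset.mem_univ _⟩
      rw [← Finset.mul_prod_erase _ _ (Finset.mem_univ i),
        ← Finset.mul_prod_erase _ l (Finset.mem_univ i),
        ← Finset.mul_prod_erase _ _ hmem, ← Finset.mul_prod_erase _ l hmem,
        ← mul_assoc, ← mul_assoc]
      refine Nat.mul_lt_mul_of_lt_of_le (hlt j hj) (Finset.prod_le_prod' fun m hm => ?_)
        (Finset.prod_pos fun m _ => hlpos m)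
      exact hle m (Finset.mem_erase.1 (Finset.mem_erase.1 hm).2).1
    exact ⟨hprod.le, fun h => absurd h hprod.ne⟩
  push Not at hbig
  refine ⟨Finset.prod_le_prod' fun i _ => hbig i, fun heq => ?_⟩
  have hcard : ∀ i, (A i).card = l i := by
    by_contra! h
    obtain ⟨i, hi⟩ := h
    have hApos : ∀ j ∈ Finset.univ, 0 < (A j).card := fun j hj =>
      Nat.pos_of_ne_zero (Finset.prod_ne_zero_iff.1
        (heq ▸ (Finset.prod_pos fun m _ => hlpos m).ne') j hj)
    exact (Finset.prod_lt_prod hApos (fun j _ => hbig j)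
      ⟨i, Finset.mem_univ i, lt_of_le_of_ne (hbig i) hi⟩).ne heq
  have hcommon : ∀ i j, i ≠ j →
      ∃ T : Finset α, T.card = t ∧ (∀ a ∈ A i, T ⊆ a) ∧ ∀ b ∈ A j, T ⊆ b := fun i j hij =>
    (hpair i j hij).resolve_right (by rw [hcard, hcard]; exact lt_irrefl _)
  let i₀ : Fin k := ⟨0, by omega⟩
  obtain ⟨T, hT, hT0, -⟩ := hcommon i₀ ⟨1, by omega⟩ (by simp [i₀])
  refine ⟨T, hT, fun i => ?_⟩
  suffices hTi : ∀ a ∈ A i, T ⊆ a from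
    Finset.eq_of_subset_of_card_le (subset_famStar (hAF i) hTi)
      ((hmax i T hT).trans_eq (hcard i).symm)
  by_cases hi : i = i₀
  · rw [hi]; exact hT0
  obtain ⟨T', hT', hT'0, hT'i⟩ := hcommon i₀ i (Ne.symm hi)
  suffices T = T' by rw [this]; exact hT'i
  by_contra hne
  have hlt : t < (T ∪ T').card := by
    by_contra! h
    have h1 := Finset.eq_of_subset_of_card_le Finset.subset_union_left (h.trans_eq hT.symm)
    have h2 := Finset.eq_of_subset_of_card_le Finset.subset_union_right (h.trans_eq hT'.symm)
    exact hne (h1.trans h2.symm)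
  obtain ⟨U, hU, hUc⟩ := Finset.exists_subset_card_eq (Nat.succ_le_of_lt hlt)
  have h1 : (A i₀).card ≤ M i₀ := (Finset.card_le_card (subset_famStar (hAF i₀) fun a ha =>
    hU.trans (Finset.union_subset (hT0 a ha) (hT'0 a ha)))).trans (hM i₀ U hUc)
  have h2 := hDM i₀
  have h3 : M i₀ ≤ D * M i₀ := Nat.le_mul_of_pos_left _ hD0
  have h4 : (A i₀).card = (famStar (F i₀) T₀).card := hcard i₀
  omega

theorem card_piAntidiag_nat (s : Finset ℕ) (q : ℕ) :
    (s.piAntidiag q).card = s.card.multichoose q := by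
  rw [← Finset.card_finsuppAntidiag_nat_eq_multichoose]
  simp [Finset.finsuppAntidiag]

/-- The multiplicity of `a` in the multiset represented by `S`. -/
def multiplicityAt (S : Finset (ℕ × ℕ)) (a : ℕ) : ℕ :=
  (S.filter fun p => p.1 = a).card

theorem sum_multiplicityAt {S : Finset (ℕ × ℕ)} {X : Finset ℕ} (h : ∀ p ∈ S, p.1 ∈ X) :
    ∑ a ∈ X, multiplicityAt S a = S.card :=
  (Finset.card_eq_sum_card_fiberwise h).symm

theorem multiplicityAt_mono {U S : Finset (ℕ × ℕ)} (h : U ⊆ S) (a : ℕ) :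
    multiplicityAt U a ≤ multiplicityAt S a :=
  Finset.card_le_card (Finset.filter_subset_filter _ h)

theorem mem_multFam {n r : ℕ} {S : Finset (ℕ × ℕ)} :
    S ∈ multFam n r ↔ S ⊆ Finset.Icc 1 n ×ˢ Finset.Icc 1 r ∧ S.card = r ∧
      ∀ p ∈ S, ∀ j ∈ Finset.Icc 1 p.2, (p.1, j) ∈ S := by
  simp only [multFam, Finset.mem_filter, Finset.mem_powerset]

theorem mem_iff_le_multiplicityAt {n r : ℕ} {S : Finset (ℕ × ℕ)} (hS : S ∈ multFam n r)
    (a j : ℕ) : (a, j) ∈ S ↔ 1 ≤ j ∧ j ≤ multiplicityAt S a := by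
  obtain ⟨hsub, -, hdown⟩ := mem_multFam.1 hS
  have hpos : ∀ p ∈ S, 1 ≤ p.2 := fun p hp =>
    (Finset.mem_Icc.1 (Finset.mem_product.1 (hsub hp)).2).1
  constructor
  · intro h
    refine ⟨hpos _ h, ?_⟩
    have : ({a} : Finset ℕ) ×ˢ Finset.Icc 1 j ⊆ S.filter fun p => p.1 = a := by
      rintro ⟨b, i⟩ hp
      simp only [Finset.mem_product, Finset.mem_singleton] at hp
      obtain ⟨rfl, hi⟩ := hp
      exact Finset.mem_filter.2 ⟨hdown _ h i hi, rfl⟩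
    simpa [multiplicityAt] using Finset.card_le_card this
  · rintro ⟨hj, hle⟩
    by_contra hnot
    have : (S.filter fun p => p.1 = a) ⊆ ({a} : Finset ℕ) ×ˢ Finset.Icc 1 (j - 1) := by
      rintro ⟨b, i⟩ hp
      obtain ⟨hp', rfl⟩ := Finset.mem_filter.1 hp
      have hi : i < j := by
        by_contra! hji
        exact hnot (hdown _ hp' j (Finset.mem_Icc.2 ⟨hj, hji⟩))
      have hi1 : 1 ≤ i := hpos _ hp'
      exact Finset.mem_product.2 ⟨Finset.mem_singleton_self _, Finset.mem_Icc.2 ⟨hi1, by omega⟩⟩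
    have hcard := Finset.card_le_card this
    simp only [Finset.card_product, Finset.card_singleton, Nat.card_Icc, one_mul] at hcard
    simp only [multiplicityAt] at hle
    omega

theorem multFam_ext {n r : ℕ} {S S' : Finset (ℕ × ℕ)} (hS : S ∈ multFam n r)
    (hS' : S' ∈ multFam n r) (h : multiplicityAt S = multiplicityAt S') : S = S' := by
  ext ⟨a, j⟩
  rw [mem_iff_le_multiplicityAt hS, mem_iff_le_multiplicityAt hS', h]

theorem card_famStar_multFam_le (n r : ℕ) (U : Finset (ℕ × ℕ)) :
    (famStar (multFam n r) U).card ≤ n.multichoose (r - U.card) := by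
  have hcard : n.multichoose (r - U.card) =
      ((Finset.Icc 1 n).piAntidiag (r - U.card)).card := by
    rw [card_piAntidiag_nat, Nat.card_Icc, Nat.add_sub_cancel]
  rw [hcard]
  refine Finset.card_le_card_of_injOn
    (fun S a => multiplicityAt S a - multiplicityAt U a) ?_ ?_
  · intro S hS
    obtain ⟨hS, hUS⟩ := Finset.mem_filter.1 hS
    obtain ⟨hsub, hSc, -⟩ := mem_multFam.1 hS
    have hfst : ∀ p ∈ S, p.1 ∈ Finset.Icc 1 n := fun p hp => (Finset.mem_product.1 (hsub hp)).1
    rw [Finset.mem_coe, Finset.mem_piAntidiag]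
    constructor
    · rw [Finset.sum_tsub_distrib _ fun a _ => multiplicityAt_mono hUS a,
        sum_multiplicityAt hfst, sum_multiplicityAt fun p hp => hfst p (hUS hp), hSc]
    · intro a ha
      obtain ⟨p, hp⟩ := Finset.card_pos.1 (Nat.pos_of_ne_zero fun h : multiplicityAt S a = 0 =>
        ha (show multiplicityAt S a - multiplicityAt U a = 0 by rw [h, Nat.zero_sub]))
      obtain ⟨hpS, rfl⟩ := Finset.mem_filter.1 hp
      exact hfst p hpS
  · intro S hS S' hS' h
    obtain ⟨hS, hUS⟩ := Finset.mem_filter.1 hS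
    obtain ⟨hS', hUS'⟩ := Finset.mem_filter.1 hS'
    refine multFam_ext hS hS' (funext fun a => ?_)
    have h1 := multiplicityAt_mono hUS a
    have h2 := multiplicityAt_mono hUS' a
    have h3 : multiplicityAt S a - multiplicityAt U a =
      multiplicityAt S' a - multiplicityAt U a := congrFun h a
    omega

/-- The representation of the multiset with members at most `n` and multiplicities `f`. -/
def ofMultiplicity (n r : ℕ) (f : ℕ → ℕ) : Finset (ℕ × ℕ) :=
  (Finset.Icc 1 n ×ˢ Finset.Icc 1 r).filter fun p => p.2 ≤ f p.1

theorem multiplicityAt_ofMultiplicity {n r a : ℕ} {f : ℕ → ℕ} (ha : a ∈ Finset.Icc 1 n)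
    (hf : f a ≤ r) : multiplicityAt (ofMultiplicity n r f) a = f a := by
  have : ((ofMultiplicity n r f).filter fun p => p.1 = a) =
      ({a} : Finset ℕ) ×ˢ Finset.Icc 1 (f a) := by
    ext ⟨b, j⟩
    simp only [ofMultiplicity, Finset.mem_filter, Finset.mem_product, Finset.mem_singleton,
      Finset.mem_Icc] at ha ⊢
    constructor
    · rintro ⟨h, rfl⟩
      omega
    · rintro ⟨rfl, h⟩
      omega
  rw [multiplicityAt, this, Finset.card_product, Finset.card_singleton, Nat.card_Icc]
  omega

theorem ofMultiplicity_mem_multFam {n r : ℕ} {f : ℕ → ℕ}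
    (hf : ∑ a ∈ Finset.Icc 1 n, f a = r) : ofMultiplicity n r f ∈ multFam n r := by
  refine mem_multFam.2 ⟨Finset.filter_subset _ _, ?_, ?_⟩
  · have hfst : ∀ p ∈ ofMultiplicity n r f, p.1 ∈ Finset.Icc 1 n := fun p hp =>
      (Finset.mem_product.1 (Finset.mem_filter.1 hp).1).1
    rw [← sum_multiplicityAt hfst]
    conv_rhs => rw [← hf]
    exact Finset.sum_congr rfl fun a ha => multiplicityAt_ofMultiplicity ha
      (hf ▸ Finset.single_le_sum (fun _ _ => Nat.zero_le _) ha)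
  · rintro ⟨a, j⟩ hp i hi
    simp only [ofMultiplicity, Finset.mem_filter, Finset.mem_product, Finset.mem_Icc] at hp hi ⊢
    omega

theorem multichoose_le_card_famStar_multFam {n r t : ℕ} (hn : 1 ≤ n) (htr : t ≤ r) :
    n.multichoose (r - t) ≤
      (famStar (multFam n r) (({1} : Finset ℕ) ×ˢ Finset.Icc 1 t)).card := by
  have hcard : n.multichoose (r - t) = ((Finset.Icc 1 n).piAntidiag (r - t)).card := by
    rw [card_piAntidiag_nat, Nat.card_Icc, Nat.add_sub_cancel]
  have h1 : 1 ∈ Finset.Icc 1 n := Finset.mem_Icc.2 ⟨le_rfl, hn⟩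
  have hsum : ∀ g ∈ (Finset.Icc 1 n).piAntidiag (r - t),
      ∑ a ∈ Finset.Icc 1 n, (g a + if a = 1 then t else 0) = r := by
    intro g hg
    rw [Finset.sum_add_distrib, (Finset.mem_piAntidiag.1 hg).1, Finset.sum_ite_eq' _ 1,
      if_pos h1, Nat.sub_add_cancel htr]
  rw [hcard]
  refine Finset.card_le_card_of_injOn
    (fun g => ofMultiplicity n r fun a => g a + if a = 1 then t else 0) ?_ ?_
  · intro g hg
    refine Finset.mem_filter.2 ⟨ofMultiplicity_mem_multFam (hsum g hg), ?_⟩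
    rintro ⟨a, j⟩ hp
    simp only [Finset.mem_product, Finset.mem_singleton, Finset.mem_Icc] at hp
    obtain ⟨rfl, hj⟩ := hp
    simp only [ofMultiplicity, Finset.mem_filter, Finset.mem_product, Finset.mem_Icc, if_true]
    omega
  · intro g hg g' hg' h
    funext a
    by_cases ha : a ∈ Finset.Icc 1 n
    · have key : ∀ g ∈ (Finset.Icc 1 n).piAntidiag (r - t), multiplicityAt
          (ofMultiplicity n r fun a => g a + if a = 1 then t else 0) a =
            g a + if a = 1 then t else 0 := fun g hg =>
        multiplicityAt_ofMultiplicity ha ((Finset.single_le_sum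
          (f := fun a => g a + if a = 1 then t else 0) (fun _ _ => Nat.zero_le _) ha).trans_eq
            (hsum g hg))
      have h2 := congrArg (fun S => multiplicityAt S a) h
      simp only [key g hg, key g' hg'] at h2
      exact Nat.add_right_cancel h2
    · have h0 : ∀ g ∈ (Finset.Icc 1 n).piAntidiag (r - t), g a = 0 := fun g hg => by
        by_contra h
        exact ha ((Finset.mem_piAntidiag.1 hg).2 a h)
      rw [h0 g hg, h0 g' hg']

theorem mul_multichoose_lt_multichoose_succ {D n q : ℕ} (h : (q + 1) * D + 1 ≤ n) :
    D * n.multichoose q < n.multichoose (q + 1) := by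
  have h1 : (n + q) * n.multichoose q = n.multichoose (q + 1) * (q + 1) := by
    obtain ⟨m, rfl⟩ : ∃ m, n = m + 1 := ⟨n - 1, by omega⟩
    rw [Nat.multichoose_eq, Nat.multichoose_eq, show m + 1 + q - 1 = m + q by omega,
      show m + 1 + (q + 1) - 1 = m + q + 1 by omega, show m + 1 + q = m + q + 1 by omega]
    exact Nat.add_one_mul_choose_eq (m + q) q
  have h2 : 0 < n.multichoose q := by
    rw [Nat.multichoose_eq]; exact Nat.choose_pos (by omega)
  have h3 : (q + 1) * D < n + q := by omega
  nlinarith [Nat.mul_lt_mul_of_pos_right h3 h2]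

/-- Theorem 4.9 (families of multisets); the condition
n_i ≥ (r_i − t)·c(r_{k−1},r_k,t) − r_i + t + 1 is stated additively to avoid
truncated subtraction. -/
theorem stmt_14 {k : ℕ} (hk : 2 ≤ k) (t : ℕ) (ht : 1 ≤ t)
    (r n : Fin k → ℕ) (hmono : Monotone r) (htr : t ≤ r ⟨0, by omega⟩)
    (hn : ∀ i, (r i - t) * cfun (r ⟨k - 2, by omega⟩) (r ⟨k - 1, by omega⟩) t + t + 1
      ≤ n i + r i) :
    ExtrastrongCrossTStar t (fun i => multFam (n i) (r i)) := by
  set D := max (r ⟨k - 2, by omega⟩ * (r ⟨k - 1, by omega⟩).choose t)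
    (r ⟨k - 1, by omega⟩ * (r ⟨k - 2, by omega⟩).choose t) with hDdef
  have htr' : ∀ i, t ≤ r i := fun i => htr.trans (hmono (Nat.zero_le _))
  rw [cfun, if_pos (le_min (htr' _) (htr' _)), ← hDdef] at hn
  have hn1 : ∀ i, (r i - t) * D + 1 ≤ n i := fun i => by
    have h := hn i
    rw [Nat.mul_add_one] at h
    have := htr' i
    omega
  have hD : ∀ i j, i < j → max (r i * (r j).choose t) (r j * (r i).choose t) ≤ D := by
    intro i j hij
    have h1 : r i ≤ r ⟨k - 2, by omega⟩ := hmono (Fin.le_def.2 (by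
      have := j.2; have := Fin.lt_def.1 hij; show i.1 ≤ k - 2; omega))
    have h2 : r j ≤ r ⟨k - 1, by omega⟩ := hmono (Fin.le_def.2 (by
      have := j.2; show j.1 ≤ k - 1; omega))
    exact max_le_max (Nat.mul_le_mul h1 (Nat.choose_le_choose t h2))
      (Nat.mul_le_mul h2 (Nat.choose_le_choose t h1))
  have hT₀ : (({1} : Finset ℕ) ×ˢ Finset.Icc 1 t).card = t := by simp
  have hstar : ∀ i, (n i).multichoose (r i - t) ≤
      (famStar (multFam (n i) (r i)) (({1} : Finset ℕ) ×ˢ Finset.Icc 1 t)).card := fun i =>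
    multichoose_le_card_famStar_multFam (by have := hn1 i; omega) (htr' i)
  refine extrastrongCrossTStar_of_card_famStar (D := D) (r := r)
    (M := fun i => if t < r i then (n i).multichoose (r i - (t + 1)) else 0)
    hk (fun i a ha => (mem_multFam.1 ha).2.1) hT₀ ?_ ?_ ?_ ?_ ?_
  · intro i T hT
    exact ((card_famStar_multFam_le _ _ T).trans_eq (by rw [hT])).trans (hstar i)
  · intro i U hU
    split_ifs with h
    · exact (card_famStar_multFam_le _ _ U).trans_eq (by rw [hU])
    · refine (Finset.card_eq_zero.2 (Finset.filter_eq_empty_iff.2 fun S hS hUS => h ?_)).le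
      have h1 := Finset.card_le_card hUS
      rw [hU, (mem_multFam.1 hS).2.1] at h1
      exact h1
  · intro i
    refine lt_of_lt_of_le ?_ (hstar i)
    split_ifs with h
    · obtain ⟨q, hq⟩ : ∃ q, r i = t + 1 + q := Nat.exists_eq_add_of_le h
      have h1 := hn1 i
      rw [hq, show t + 1 + q - t = q + 1 by omega] at h1 ⊢
      rw [Nat.add_sub_cancel_left]
      exact mul_multichoose_lt_multichoose_succ h1
    · have h1 : r i - t = 0 := by omega
      rw [h1, Nat.multichoose_zero_right, Nat.mul_zero]
      exact Nat.one_pos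
  · exact le_trans (Nat.mul_pos (ht.trans (htr' _)) (Nat.choose_pos (htr' _))) (le_max_left _ _)
  · intro i j hij
    rcases lt_or_gt_of_ne hij with h | h
    · exact (le_max_left _ _).trans (hD i j h)
    · exact (le_max_right _ _).trans (hD j i h)
end

section
/- Let k ≥ 2 and 2 ≤ t+1 < r_1 ≤ … ≤ r_k, and for each i ∈ [k] let ℱ_i = 𝒞_{n_i,r_i}, where n_i ≥ (r_i − t − 1)·c(r_{k−1},r_k,t) + t + 1. Then (ℱ_1, …, ℱ_k) has the extrastrong cross-t-star property. -/
open Finset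

section CrossIntersecting

variable {α : Type*} [DecidableEq α]

/-- If every member of `B ⊆ F` contains the `t`-set `T` and `t`-intersects a set `a` not
containing `T`, then `|B|` is controlled by the stars of `F` over one-element extensions of `T`. -/
theorem card_le_mul_of_star_extension {F B : Finset (Finset α)} {T a : Finset α} {t M : ℕ}
    (hT : T.card = t) (hM : ∀ U : Finset α, U.card = t + 1 → (famStar F U).card ≤ M)
    (hBF : B ⊆ F) (hBT : ∀ b ∈ B, T ⊆ b) (hab : ∀ b ∈ B, t ≤ (a ∩ b).card) (haT : ¬ T ⊆ a) :
    B.card ≤ a.card * M := by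
  have hsub : B ⊆ (a \ T).biUnion (fun x => famStar F (insert x T)) := by
    intro b hb
    have hlt : (T ∩ (a ∩ b)).card < (a ∩ b).card := by
      refine lt_of_lt_of_le ?_ (hab b hb)
      rw [← hT]
      refine card_lt_card ⟨inter_subset_left, fun h => haT fun x hx => ?_⟩
      have := h hx
      simp only [mem_inter] at this
      exact this.2.1
    obtain ⟨x, hx, hxT⟩ := exists_mem_notMem_of_card_lt_card hlt
    simp only [mem_inter] at hx hxT
    simp only [mem_biUnion, mem_sdiff, famStar, mem_filter]
    refine ⟨x, ⟨hx.1, fun h => hxT ⟨h, hx⟩⟩, hBF hb, ?_⟩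
    exact insert_subset hx.2 (hBT b hb)
  calc B.card ≤ _ := card_le_card hsub
    _ ≤ (a \ T).card * M := by
      refine card_biUnion_le_card_mul _ _ _ fun x hx => hM _ ?_
      rw [card_insert_of_notMem (mem_sdiff.1 hx).2, hT]
    _ ≤ a.card * M := Nat.mul_le_mul_right _ (card_le_card sdiff_subset)

/-- A family all of whose members `t`-intersect `b` is covered by its stars over the
`t`-subsets of `b`. -/
theorem card_le_choose_mul {A : Finset (Finset α)} {b : Finset α} {t D : ℕ}
    (hab : ∀ a ∈ A, t ≤ (a ∩ b).card)
    (hD : ∀ T : Finset α, T.card = t → T ⊆ b → (famStar A T).card ≤ D) :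
    A.card ≤ b.card.choose t * D := by
  have hsub : A ⊆ (powersetCard t b).biUnion (fun T => famStar A T) := by
    intro a ha
    obtain ⟨T, hT, hTc⟩ := exists_subset_card_eq (hab a ha)
    simp only [mem_biUnion, mem_powersetCard, famStar, mem_filter]
    exact ⟨T, ⟨hT.trans inter_subset_right, hTc⟩, ha, hT.trans inter_subset_left⟩
  calc A.card ≤ _ := card_le_card hsub
    _ ≤ (powersetCard t b).card * D := by
      refine card_biUnion_le_card_mul _ _ _ fun T hT => ?_
      exact hD T (mem_powersetCard.1 hT).2 (mem_powersetCard.1 hT).1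
    _ = _ := by rw [card_powersetCard]

/-- Members of `A` that `t`-intersect all members of the nonempty family `B`, where no `t`-set
lies in every member of `B`. -/
theorem card_le_of_not_star {F A B : Finset (Finset α)} {t s M : ℕ} (hAF : A ⊆ F)
    (hM : ∀ U : Finset α, U.card = t + 1 → (famStar F U).card ≤ M)
    (hs : ∀ b ∈ B, b.card ≤ s) (hB : B.Nonempty)
    (hab : ∀ a ∈ A, ∀ b ∈ B, t ≤ (a ∩ b).card)
    (hns : ∀ T : Finset α, T.card = t → ∃ b ∈ B, ¬ T ⊆ b) :
    A.card ≤ s * s.choose t * M := by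
  obtain ⟨b₀, hb₀⟩ := hB
  have h : A.card ≤ b₀.card.choose t * (s * M) := by
    refine card_le_choose_mul (fun a ha => hab a ha b₀ hb₀) fun T hT _ => ?_
    obtain ⟨b, hb, hTb⟩ := hns T hT
    refine (card_le_mul_of_star_extension (F := F) (a := b) hT hM
      ((filter_subset _ _).trans hAF) ?_ ?_ hTb).trans (Nat.mul_le_mul_right _ (hs b hb))
    · exact fun a ha => (mem_filter.1 ha).2
    · intro a ha
      rw [inter_comm]
      exact hab a (mem_filter.1 ha).1 b hb
  refine h.trans ?_
  calc b₀.card.choose t * (s * M) ≤ s.choose t * (s * M) :=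
        Nat.mul_le_mul_right _ (Nat.choose_le_choose t (hs b₀ hb₀))
    _ = _ := by ring

/-- One family is a star, the other one is not contained in the corresponding star. -/
theorem card_mul_lt_of_star {F G A B : Finset (Finset α)} {T : Finset α} {r s t c L L' M' : ℕ}
    (hT : T.card = t) (hAF : A ⊆ F) (hBG : B ⊆ G)
    (hr : ∀ a ∈ A, a.card ≤ r) (hs : ∀ b ∈ B, b.card ≤ s)
    (hL : ∀ U : Finset α, U.card = t → (famStar F U).card ≤ L)
    (hM' : ∀ U : Finset α, U.card = t + 1 → (famStar G U).card ≤ M')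
    (hc : r * s.choose t < c) (hcM' : c * M' ≤ L') (hL0 : 0 < L) (hL'0 : 0 < L')
    (hB : B.Nonempty) (hab : ∀ a ∈ A, ∀ b ∈ B, t ≤ (a ∩ b).card)
    (hBT : ∀ b ∈ B, T ⊆ b) (hAT : ¬ ∀ a ∈ A, T ⊆ a) :
    A.card * B.card < L * L' := by
  push Not at hAT
  obtain ⟨a, ha, haT⟩ := hAT
  obtain ⟨b₀, hb₀⟩ := hB
  have hBle : B.card ≤ r * M' :=
    (card_le_mul_of_star_extension hT hM' hBG hBT (hab a ha) haT).trans
      (Nat.mul_le_mul_right _ (hr a ha))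
  have hAle : A.card ≤ s.choose t * L := by
    refine (card_le_choose_mul (D := L) (fun a ha => hab a ha b₀ hb₀) fun U hU _ =>
      (card_le_card (filter_subset_filter _ hAF)).trans (hL U hU)).trans ?_
    exact Nat.mul_le_mul_right _ (Nat.choose_le_choose t (hs b₀ hb₀))
  have hlt : r * s.choose t * M' < L' := by
    rcases Nat.eq_zero_or_pos M' with h | h
    · simpa [h] using hL'0
    · exact (Nat.mul_lt_mul_of_pos_right hc h).trans_le hcM'
  calc A.card * B.card ≤ (s.choose t * L) * (r * M') := Nat.mul_le_mul hAle hBle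
    _ = L * (r * s.choose t * M') := by ring
    _ < L * L' := Nat.mul_lt_mul_of_pos_left hlt hL0

/-- Two nonempty cross-`t`-intersecting families are either contained in a common star or
their sizes have a product smaller than that of the largest stars. -/
theorem common_star_or_card_mul_lt {F G A B : Finset (Finset α)} {r s t c L L' M M' : ℕ}
    (hAF : A ⊆ F) (hBG : B ⊆ G) (hA : A.Nonempty) (hB : B.Nonempty)
    (hr : ∀ a ∈ A, a.card ≤ r) (hs : ∀ b ∈ B, b.card ≤ s)
    (hL : ∀ U : Finset α, U.card = t → (famStar F U).card ≤ L)
    (hL' : ∀ U : Finset α, U.card = t → (famStar G U).card ≤ L')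
    (hM : ∀ U : Finset α, U.card = t + 1 → (famStar F U).card ≤ M)
    (hM' : ∀ U : Finset α, U.card = t + 1 → (famStar G U).card ≤ M')
    (hc : r * s.choose t < c) (hc' : s * r.choose t < c)
    (hcM : c * M ≤ L) (hcM' : c * M' ≤ L') (hL0 : 0 < L) (hL'0 : 0 < L')
    (hab : ∀ a ∈ A, ∀ b ∈ B, t ≤ (a ∩ b).card) :
    (∃ T : Finset α, T.card = t ∧ A ⊆ famStar F T ∧ B ⊆ famStar G T) ∨
      A.card * B.card < L * L' := by
  have hba : ∀ b ∈ B, ∀ a ∈ A, t ≤ (b ∩ a).card := fun b hb a ha => by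
    rw [inter_comm]; exact hab a ha b hb
  by_cases hBs : ∃ T : Finset α, T.card = t ∧ ∀ b ∈ B, T ⊆ b
  · obtain ⟨T, hT, hBT⟩ := hBs
    by_cases hAT : ∀ a ∈ A, T ⊆ a
    · exact .inl ⟨T, hT, fun a ha => mem_filter.2 ⟨hAF ha, hAT a ha⟩,
        fun b hb => mem_filter.2 ⟨hBG hb, hBT b hb⟩⟩
    · exact .inr (card_mul_lt_of_star hT hAF hBG hr hs hL hM' hc hcM' hL0 hL'0 hB hab hBT hAT)
  by_cases hAs : ∃ T : Finset α, T.card = t ∧ ∀ a ∈ A, T ⊆ a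
  · obtain ⟨T, hT, hAT⟩ := hAs
    refine .inr ?_
    rw [mul_comm, mul_comm L]
    exact card_mul_lt_of_star hT hBG hAF hs hr hL' hM hc' hcM hL'0 hL0 hA hba hAT
      fun h => hBs ⟨T, hT, h⟩
  push Not at hBs hAs
  have h1 := card_le_of_not_star hAF hM hs hB hab hBs
  have h2 := card_le_of_not_star hBG hM' hr hA hba hAs
  have key : ∀ {P N K : ℕ}, P < c → c * N ≤ K → 0 < K → P * N < K := by
    intro P N K hP hN hK
    rcases Nat.eq_zero_or_pos N with h | h
    · simpa [h] using hK
    · exact (Nat.mul_lt_mul_of_pos_right hP h).trans_le hN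
  refine .inr ?_
  calc A.card * B.card ≤ (s * s.choose t * M) * (r * r.choose t * M') := Nat.mul_le_mul h1 h2
    _ = (r * s.choose t * M) * (s * r.choose t * M') := by ring
    _ < L * L' := Nat.mul_lt_mul'' (key hc hcM hL0) (key hc' hcM' hL'0)

/-- Distinct `t`-sets have distinct stars when these are larger than all `(t+1)`-stars. -/
theorem eq_of_famStar_eq {F : Finset (Finset α)} {T T' : Finset α} {t M : ℕ}
    (hT : T.card = t) (hT' : T'.card = t)
    (hM : ∀ U : Finset α, U.card = t + 1 → (famStar F U).card ≤ M)
    (hlt : M < (famStar F T).card) (h : famStar F T = famStar F T') : T = T' := by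
  by_contra hne
  have hns : ¬ T' ⊆ T := fun hs => hne (eq_of_subset_of_card_le hs (by omega)).symm
  obtain ⟨x, hx, hxT⟩ := not_subset.1 hns
  have h1 := hM (insert x T) (by rw [card_insert_of_notMem hxT, hT])
  refine absurd (hlt.trans_le ((card_le_card ?_).trans h1)) (lt_irrefl _)
  intro S hS
  have hS' := hS
  rw [h] at hS'
  simp only [famStar, mem_filter] at hS hS' ⊢
  exact ⟨hS.1, insert_subset (hS'.2 hx) hS.2⟩

/-- Passing from pairs of families to `k`-tuples. -/
theorem extrastrongCrossTStar_of_pairs {k t : ℕ} (hk : 2 ≤ k) {F : Fin k → Finset (Finset α)}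
    {T₀ : Finset α} (hT₀ : T₀.card = t) (M : Fin k → ℕ)
    (hL : ∀ i, ∀ U : Finset α, U.card = t → (famStar (F i) U).card ≤ (famStar (F i) T₀).card)
    (hM : ∀ i, ∀ U : Finset α, U.card = t + 1 → (famStar (F i) U).card ≤ M i)
    (hML : ∀ i, M i < (famStar (F i) T₀).card)
    (hpair : ∀ i j, i < j → ∀ A B : Finset (Finset α), A ⊆ F i → B ⊆ F j → A.Nonempty →
      B.Nonempty → (∀ a ∈ A, ∀ b ∈ B, t ≤ (a ∩ b).card) →
      (∃ T : Finset α, T.card = t ∧ A ⊆ famStar (F i) T ∧ B ⊆ famStar (F j) T) ∨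
        A.card * B.card < (famStar (F i) T₀).card * (famStar (F j) T₀).card) :
    ExtrastrongCrossTStar t F := by
  refine ⟨T₀, hT₀, fun A hA hAF => ?_⟩
  set L : Fin k → ℕ := fun i => (famStar (F i) T₀).card with hLdef
  have hL0 : ∀ i, 0 < L i := fun i => Nat.zero_lt_of_lt (hML i)
  have hLprod : 0 < ∏ i, L i := prod_pos fun i _ => hL0 i
  by_cases hne : ∀ i, (A i).Nonempty
  swap
  · push Not at hne
    obtain ⟨i, hi⟩ := hne
    have h0 : ∏ i, (A i).card = 0 := prod_eq_zero (mem_univ i) (by simp [hi])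
    rw [h0]
    exact ⟨Nat.zero_le _, fun h => absurd h hLprod.ne⟩
  have hpos : ∀ i, 0 < (A i).card := fun i => card_pos.2 (hne i)
  have hpair' : ∀ i j, i ≠ j →
      (∃ T : Finset α, T.card = t ∧ A i ⊆ famStar (F i) T ∧ A j ⊆ famStar (F j) T) ∨
        (A i).card * (A j).card < L i * L j := by
    intro i j hij
    rcases lt_or_gt_of_ne hij with h | h
    · exact hpair i j h _ _ (hAF i) (hAF j) (hne i) (hne j) (hA i j hij)
    · rcases hpair j i h _ _ (hAF j) (hAF i) (hne j) (hne i) (hA j i hij.symm) with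
        ⟨T, hT, h1, h2⟩ | h1
      · exact .inl ⟨T, hT, h2, h1⟩
      · exact .inr (by rw [mul_comm, mul_comm (L i)]; exact h1)
  have hstar : ∀ i T, T.card = t → A i ⊆ famStar (F i) T → (A i).card ≤ L i :=
    fun i T hT h => (card_le_card h).trans (hL i T hT)
  have hle : ∀ i j, i ≠ j → (A i).card * (A j).card ≤ L i * L j := by
    intro i j hij
    rcases hpair' i j hij with ⟨T, hT, h1, h2⟩ | h
    · exact Nat.mul_le_mul (hstar i T hT h1) (hstar j T hT h2)
    · exact h.le
  obtain ⟨m, rfl⟩ : ∃ m, k = m + 2 := ⟨k - 2, by omega⟩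
  let σ : Equiv.Perm (Fin (m + 2)) := finRotate (m + 2)
  have hσ : ∀ i, i ≠ σ i := by
    intro i h
    have h2 : i + 1 = i := by
      rw [← finRotate_apply]; exact h.symm
    simp at h2
  have hsq : ∀ f : Fin (m + 2) → ℕ, ∏ i, f i * f (σ i) = (∏ i, f i) ^ 2 := by
    intro f
    rw [prod_mul_distrib, Equiv.prod_comp σ f, sq]
  have hmain : ∏ i, (A i).card ≤ ∏ i, L i := by
    refine (Nat.pow_le_pow_iff_left two_ne_zero).1 ?_
    rw [← hsq, ← hsq]
    exact prod_le_prod' fun i _ => hle i (σ i) (hσ i)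
  refine ⟨hmain, fun heq => ?_⟩
  have heqσ : ∀ i, (A i).card * (A (σ i)).card = L i * L (σ i) := by
    intro i
    refine le_antisymm (hle i _ (hσ i)) (not_lt.1 fun hlt => ?_)
    have := prod_lt_prod (s := univ) (f := fun i => (A i).card * (A (σ i)).card)
      (g := fun i => L i * L (σ i)) (fun i _ => Nat.mul_pos (hpos _) (hpos _))
      (fun i _ => hle i (σ i) (hσ i)) ⟨i, mem_univ i, hlt⟩
    rw [hsq (fun i => (A i).card), hsq L, heq] at this
    exact lt_irrefl _ this
  have hAL : ∀ i, (A i).card = L i := by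
    intro i
    rcases hpair' i (σ i) (hσ i) with ⟨T, hT, h1, h2⟩ | h
    · have e1 := hstar i T hT h1
      have e2 := hstar _ T hT h2
      refine le_antisymm e1 (not_lt.1 fun hlt => ?_)
      exact (Nat.mul_lt_mul_of_lt_of_le hlt e2 (hL0 _)).ne (heqσ i)
    · exact absurd (heqσ i) h.ne
  have hcommon : ∀ i j, i ≠ j →
      ∃ T : Finset α, T.card = t ∧ A i = famStar (F i) T ∧ A j = famStar (F j) T := by
    intro i j hij
    rcases hpair' i j hij with ⟨T, hT, h1, h2⟩ | h
    · exact ⟨T, hT, eq_of_subset_of_card_le h1 ((hL i T hT).trans (hAL i).ge),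
        eq_of_subset_of_card_le h2 ((hL j T hT).trans (hAL j).ge)⟩
    · rw [hAL, hAL] at h
      exact absurd h (lt_irrefl _)
  obtain ⟨T, hT, h0, -⟩ := hcommon 0 (σ 0) (hσ 0)
  refine ⟨T, hT, fun j => ?_⟩
  by_cases hj : j = 0
  · rw [hj, h0]
  obtain ⟨T', hT', h0', hj'⟩ := hcommon 0 j (Ne.symm hj)
  have : T = T' := by
    refine eq_of_famStar_eq hT hT' (hM 0) ?_ (h0.symm.trans h0')
    rw [← h0, hAL]
    exact hML 0
  rw [hj', this]

end CrossIntersecting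

section Compositions

theorem mem_compFam_iff {n r : ℕ} {S : Finset (ℕ × ℕ)} :
    S ∈ compFam n r ↔ ∃ g : ℕ → ℕ, (∀ i ∈ Icc 1 r, 1 ≤ g i) ∧ ∑ i ∈ Icc 1 r, g i = n ∧
      S = (Icc 1 r).image (fun i => (i, g i)) := by
  have hinj : ∀ g : ℕ → ℕ, Function.Injective (fun i => (i, g i)) :=
    fun g i j h => congrArg Prod.fst h
  constructor
  · intro hS
    simp only [compFam, mem_filter, mem_powerset] at hS
    obtain ⟨hsub, himg, hcard, hsum⟩ := hS
    have hfst : Set.InjOn Prod.fst (S : Set (ℕ × ℕ)) := by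
      refine card_image_iff.1 ?_
      rw [himg, hcard]; simp
    have hex : ∀ i, ∃ v, i ∈ Icc 1 r → (i, v) ∈ S := by
      intro i
      by_cases hi : i ∈ Icc 1 r
      · rw [← himg, mem_image] at hi
        obtain ⟨p, hp, rfl⟩ := hi
        exact ⟨p.2, fun _ => hp⟩
      · exact ⟨0, fun h => absurd h hi⟩
    choose g hg using hex
    have hSeq : (Icc 1 r).image (fun i => (i, g i)) = S := by
      refine eq_of_subset_of_card_le ?_ ?_
      · intro p hp
        obtain ⟨i, hi, rfl⟩ := mem_image.1 hp
        exact hg i hi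
      · rw [card_image_of_injective _ (hinj g), hcard]; simp
    refine ⟨g, fun i hi => ?_, ?_, hSeq.symm⟩
    · have := hsub (hg i hi)
      simp only [mem_product, mem_Icc] at this
      exact this.2.1
    · rw [← hsum, ← hSeq, sum_image fun i _ j _ h => hinj g h]
  · rintro ⟨g, hg, hsum, rfl⟩
    simp only [compFam, mem_filter, mem_powerset]
    refine ⟨?_, ?_, ?_, ?_⟩
    · intro p hp
      obtain ⟨i, hi, rfl⟩ := mem_image.1 hp
      refine mem_product.2 ⟨hi, mem_Icc.2 ⟨hg i hi, ?_⟩⟩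
      rw [← hsum]
      exact single_le_sum (f := g) (fun _ _ => Nat.zero_le _) hi
    · rw [image_image]
      exact image_id
    · rw [card_image_of_injective _ (hinj g)]; simp
    · rw [sum_image fun i _ j _ h => hinj g h, hsum]

theorem card_of_mem_compFam {n r : ℕ} {S : Finset (ℕ × ℕ)} (hS : S ∈ compFam n r) :
    S.card = r := by
  simp only [compFam, mem_filter] at hS
  exact hS.2.2.1

theorem multichoose_mono_right (m : ℕ) (hm : 0 < m) : Monotone (Nat.multichoose m) := by
  obtain ⟨m, rfl⟩ := Nat.exists_eq_add_of_lt hm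
  refine monotone_nat_of_le_succ fun k => ?_
  rw [Nat.multichoose_succ_succ]
  exact Nat.le_add_left _ _

/-- The star of a `u`-set in `𝒞_{n,r}`. -/
theorem card_famStar_compFam_le {n r u : ℕ} (hu : u < r) {T : Finset (ℕ × ℕ)}
    (hT : T.card = u) :
    (famStar (compFam n r) T).card ≤ (r - u).multichoose (n - r) := by
  rcases (famStar (compFam n r) T).eq_empty_or_nonempty with h | ⟨S₀, hS₀⟩
  · simp [h]
  obtain ⟨hS₀, hTS₀⟩ := mem_filter.1 hS₀
  obtain ⟨g₀, hg₀, hsum₀, rfl⟩ := mem_compFam_iff.1 hS₀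
  have hTg : ∀ p ∈ T, p.1 ∈ Icc 1 r ∧ p.2 = g₀ p.1 := by
    intro p hp
    obtain ⟨i, hi, rfl⟩ := mem_image.1 (hTS₀ hp)
    exact ⟨hi, rfl⟩
  set I := T.image Prod.fst with hI
  have hIcard : I.card = u := by
    rw [hI, card_image_of_injOn, hT]
    intro p hp q hq h
    exact Prod.ext h (by rw [(hTg p hp).2, (hTg q hq).2, h])
  have hIsub : I ⊆ Icc 1 r := by
    intro i hi
    obtain ⟨p, hp, rfl⟩ := mem_image.1 hi
    exact (hTg p hp).1
  set J := Icc 1 r \ I with hJ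
  have hJcard : J.card = r - u := by
    rw [hJ, card_sdiff_of_subset hIsub, hIcard]; simp
  set N := ∑ i ∈ J, (g₀ i - 1) with hN
  have hNle : N ≤ n - r := by
    calc N ≤ ∑ i ∈ Icc 1 r, (g₀ i - 1) :=
          sum_le_sum_of_subset (f := fun i => g₀ i - 1) sdiff_subset
      _ = n - r := by
        rw [sum_tsub_distrib _ hg₀, hsum₀]; simp
  have hsub : famStar (compFam n r) T ⊆ (J.finsuppAntidiag N).image
      (fun f => (Icc 1 r).image (fun i => (i, if i ∈ J then f i + 1 else g₀ i))) := by
    intro S hS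
    obtain ⟨hS, hTS⟩ := mem_filter.1 hS
    obtain ⟨g, hg, hsum, rfl⟩ := mem_compFam_iff.1 hS
    have hgI : ∀ i ∈ I, g i = g₀ i := by
      intro i hi
      obtain ⟨p, hp, rfl⟩ := mem_image.1 hi
      obtain ⟨j, hj, hjp⟩ := mem_image.1 (hTS hp)
      rw [← (hTg p hp).2, ← hjp]
    refine mem_image.2 ⟨Finsupp.onFinset J (fun i => if i ∈ J then g i - 1 else 0) ?_, ?_, ?_⟩
    · intro i hi
      by_contra h
      simp [h] at hi
    · rw [mem_finsuppAntidiag]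
      refine ⟨?_, Finsupp.support_onFinset_subset⟩
      have e1 : ∑ i ∈ J, g i = ∑ i ∈ J, g₀ i := by
        have a1 := sum_sdiff (f := g) hIsub
        have a2 := sum_sdiff (f := g₀) hIsub
        have a3 : ∑ i ∈ I, g i = ∑ i ∈ I, g₀ i := sum_congr rfl hgI
        rw [← hJ] at a1 a2
        omega
      have hJ1 : ∀ i ∈ J, i ∈ Icc 1 r := fun i hi => (mem_sdiff.1 hi).1
      calc _ = ∑ i ∈ J, (g i - 1) := by
            refine sum_congr rfl fun i hi => ?_
            simp [hi]
        _ = N := by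
          rw [hN, sum_tsub_distrib _ fun i hi => hg i (hJ1 i hi),
            sum_tsub_distrib _ fun i hi => hg₀ i (hJ1 i hi), e1]
    · refine image_congr fun i hi => ?_
      by_cases h : i ∈ J
      · have := hg i hi
        simp [h]; omega
      · have hiI : i ∈ I := by
          by_contra h'
          exact h (mem_sdiff.2 ⟨hi, h'⟩)
        simp [h, hgI i hiI]
  calc _ ≤ _ := card_le_card hsub
    _ ≤ _ := card_image_le
    _ = (r - u).multichoose N := by
      rw [card_finsuppAntidiag_nat_eq_multichoose, hJcard]
    _ ≤ _ := multichoose_mono_right _ (by omega) hNle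

/-- The star of `{(1,1), …, (u,1)}` is as large as possible. -/
theorem le_card_famStar_compFam {n r u : ℕ} (hu : u ≤ r) (hr : r ≤ n) :
    (r - u).multichoose (n - r) ≤
      (famStar (compFam n r) ((Icc 1 u).image (fun i => (i, 1)))).card := by
  have hJ : (Icc (u + 1) r).card = r - u := by simp
  rw [← hJ, ← card_finsuppAntidiag_nat_eq_multichoose]
  refine card_le_card_of_injOn (fun f => (Icc 1 r).image (fun i => (i, f i + 1))) ?_ ?_
  · intro f hf
    rw [mem_coe, mem_finsuppAntidiag] at hf
    obtain ⟨hsum, hsupp⟩ := hf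
    refine mem_filter.2 ⟨mem_compFam_iff.2 ⟨fun i => f i + 1, fun i _ => by simp, ?_, rfl⟩, ?_⟩
    · rw [sum_add_distrib]
      have : ∑ i ∈ Icc 1 r, f i = ∑ i ∈ Icc (u + 1) r, f i := by
        symm
        refine sum_subset (Icc_subset_Icc (by omega) le_rfl) fun i _ hi => ?_
        exact Finsupp.notMem_support_iff.1 fun h => hi (hsupp h)
      rw [this, hsum]
      simp; omega
    · intro p hp
      obtain ⟨i, hi, rfl⟩ := mem_image.1 hp
      rw [mem_Icc] at hi
      refine mem_image.2 ⟨i, mem_Icc.2 (by omega), ?_⟩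
      have : f i = 0 := Finsupp.notMem_support_iff.1 fun h => by
        have := mem_Icc.1 (hsupp h)
        omega
      simp [this]
  · intro f hf f' hf' h
    rw [mem_coe, mem_finsuppAntidiag] at hf hf'
    ext i
    by_cases hi : i ∈ Icc 1 r
    · have h1 : (i, f i + 1) ∈ (Icc 1 r).image (fun i => (i, f i + 1)) :=
        mem_image_of_mem (fun i => (i, f i + 1)) hi
      have h2 : (Icc 1 r).image (fun i => (i, f i + 1)) =
        (Icc 1 r).image (fun i => (i, f' i + 1)) := h
      rw [h2] at h1
      obtain ⟨j, -, hj⟩ := mem_image.1 h1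
      simp only [Prod.mk.injEq] at hj
      obtain ⟨rfl, hj⟩ := hj
      omega
    · have hi' : i ∉ Icc (u + 1) r := fun h => hi (by simp only [mem_Icc] at h ⊢; omega)
      rw [Finsupp.notMem_support_iff.1 fun h => hi' (hf.2 h),
        Finsupp.notMem_support_iff.1 fun h => hi' (hf'.2 h)]

/-- The ratio of consecutive values of `multichoose`. -/
theorem mul_multichoose_le {m N c : ℕ} (hm : 0 < m) (h : m * c ≤ m + N) :
    c * m.multichoose N ≤ (m + 1).multichoose N := by
  obtain ⟨m, rfl⟩ : ∃ l, m = l + 1 := ⟨m - 1, by omega⟩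
  have key : (m + 1 + N) * (m + N).choose N = (m + 1 + N).choose N * (m + 1) := by
    have := Nat.add_one_mul_choose_eq (m + N) m
    rw [Nat.choose_symm_of_eq_add (show m + N = m + N from rfl),
      Nat.choose_symm_of_eq_add (show m + N + 1 = (m + 1) + N by ring)] at this
    rw [show m + 1 + N = m + N + 1 by ring]
    exact this
  rw [Nat.multichoose_eq, Nat.multichoose_eq, show m + 1 + N - 1 = m + N by omega,
    show m + 1 + 1 + N - 1 = m + 1 + N by omega]
  refine Nat.le_of_mul_le_mul_right ?_ (Nat.succ_pos m)
  rw [Nat.succ_eq_add_one, ← key]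
  calc c * (m + N).choose N * (m + 1) = ((m + 1) * c) * (m + N).choose N := by ring
    _ ≤ _ := Nat.mul_le_mul_right _ h

theorem cfun_bounds {r s p q t : ℕ} (hrp : r ≤ p) (hsq : s ≤ q) (htp : t ≤ p) (htq : t ≤ q) :
    r * s.choose t < cfun p q t ∧ s * r.choose t < cfun p q t := by
  rw [cfun, if_pos (le_min htp htq)]
  have h1 : r * s.choose t ≤ p * q.choose t := Nat.mul_le_mul hrp (Nat.choose_le_choose t hsq)
  have h2 : s * r.choose t ≤ q * p.choose t := Nat.mul_le_mul hsq (Nat.choose_le_choose t hrp)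
  have := le_max_left (p * q.choose t) (q * p.choose t)
  have := le_max_right (p * q.choose t) (q * p.choose t)
  omega

end Compositions

/-- Theorem 4.10 (families of compositions). -/
theorem stmt_15 {k : ℕ} (hk : 2 ≤ k) (t : ℕ) (ht : 1 ≤ t)
    (r n : Fin k → ℕ) (hmono : Monotone r) (htr : t + 1 < r ⟨0, by omega⟩)
    (hn : ∀ i, (r i - t - 1) * cfun (r ⟨k - 2, by omega⟩) (r ⟨k - 1, by omega⟩) t + t + 1
      ≤ n i) :
    ExtrastrongCrossTStar t (fun i => compFam (n i) (r i)) := by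
  have hr0 : ∀ i, t + 1 < r i := fun i => htr.trans_le (hmono (Fin.mk_le_of_le_val (Nat.zero_le _)))
  set p := r ⟨k - 2, by omega⟩ with hp
  set q := r ⟨k - 1, by omega⟩ with hq
  have htp : t + 1 < p := hr0 _
  have htq : t + 1 < q := hr0 _
  set c := cfun p q t with hc
  have hc2 : 2 ≤ c := by
    have h := (cfun_bounds le_rfl le_rfl (by omega : t ≤ p) (by omega : t ≤ q)).1
    have h1 : 0 < p * q.choose t := Nat.mul_pos (by omega) (Nat.choose_pos (by omega))
    omega
  have hrn : ∀ i, r i ≤ n i := by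
    intro i
    have h1 := hn i
    have h2 := hr0 i
    have h3 : (r i - t - 1) * 1 ≤ (r i - t - 1) * c := Nat.mul_le_mul_left _ (by omega)
    omega
  set T₀ : Finset (ℕ × ℕ) := (Icc 1 t).image (fun i => (i, 1)) with hT₀def
  have hT₀ : T₀.card = t := by
    rw [card_image_of_injective _ fun i j h => congrArg Prod.fst h]; simp
  let M : Fin k → ℕ := fun i => (r i - (t + 1)).multichoose (n i - r i)
  have hM : ∀ i, ∀ U : Finset (ℕ × ℕ), U.card = t + 1 →
      (famStar (compFam (n i) (r i)) U).card ≤ M i :=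
    fun i U hU => card_famStar_compFam_le (hr0 i) hU
  have hlow : ∀ i, (r i - t).multichoose (n i - r i) ≤
      (famStar (compFam (n i) (r i)) T₀).card := fun i =>
    le_card_famStar_compFam (by have := hr0 i; omega) (hrn i)
  have hL : ∀ i, ∀ U : Finset (ℕ × ℕ), U.card = t →
      (famStar (compFam (n i) (r i)) U).card ≤ (famStar (compFam (n i) (r i)) T₀).card :=
    fun i U hU => (card_famStar_compFam_le (by have := hr0 i; omega) hU).trans (hlow i)
  have hcM : ∀ i, c * M i ≤ (famStar (compFam (n i) (r i)) T₀).card := by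
    intro i
    refine le_trans ?_ (hlow i)
    have h1 := hr0 i
    have h2 := hn i
    have h3 := hrn i
    rw [show r i - t = (r i - (t + 1)) + 1 by omega]
    refine mul_multichoose_le (by omega) ?_
    rw [← Nat.sub_sub]
    omega
  have hM0 : ∀ i, 0 < M i := by
    intro i
    have h1 := hr0 i
    have := multichoose_mono_right (r i - (t + 1)) (by omega) (Nat.zero_le (n i - r i))
    rw [Nat.multichoose_zero_right] at this
    exact this
  have hML : ∀ i, M i < (famStar (compFam (n i) (r i)) T₀).card := by
    intro i
    have h1 := hM0 i
    have h2 := hcM i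
    nlinarith
  refine extrastrongCrossTStar_of_pairs hk hT₀ M hL hM hML ?_
  intro i j hij A B hA hB hA0 hB0 hab
  have hip : r i ≤ p := hmono (Fin.mk_le_mk.2 (by have := j.2; have : i.1 < j.1 := hij; omega))
  have hjq : r j ≤ q := hmono (Fin.mk_le_mk.2 (by have := j.2; omega))
  obtain ⟨hc1, hc2⟩ := cfun_bounds hip hjq (by omega : t ≤ p) (by omega : t ≤ q)
  exact common_star_or_card_mul_lt hA hB hA0 hB0
    (fun a ha => (card_of_mem_compFam (hA ha)).le) (fun b hb => (card_of_mem_compFam (hB hb)).le)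
    (hL i) (hL j) (hM i) (hM j) hc1 hc2 (hcM i) (hcM j)
    (Nat.zero_lt_of_lt (hML i)) (Nat.zero_lt_of_lt (hML j)) hab
end
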